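/- Let {e_i}_{i=1}^∞ be the canonical orthonormal basis of the real Hilbert space ℓ₂, let a_i ≠ 0 for all i with Σ_{i=1}^∞ a_i² < ∞, define x_k = a_k(e_1 + e_{k+1}) for k = 1, 2, …, and let L be the right shift operator on ℓ₂ (L e_i = e_{i+1} for all i). Then the family {e_i}_{i=1}^∞ ∪ {2^{-i} L^i x_k : i = 0, 1, 2, …; k = 1, 2, …} is a frame for ℓ₂ which is injective. -/

import Mathlib

open scoped InnerProductSpace

/-- The real Hilbert space `ℓ₂`. -/
abbrev ell2 : Type := lp (fun _ : ℕ => ℝ) 2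

/-- `T` is a Hilbert–Schmidt operator on `ℓ₂`: `Σ_i ‖T e_i‖² < ∞` for the
canonical orthonormal basis `{e_i}`. -/
def IsHilbertSchmidt (T : ell2 →L[ℝ] ell2) : Prop :=
  Summable fun i : ℕ => ‖T (lp.single 2 i (1 : ℝ))‖ ^ 2

/-- Let `{e_i}` be the canonical orthonormal basis of the real
`ℓ₂` (0-indexed: `e_i = lp.single 2 i 1`), let `a_i ≠ 0` with `Σ a_i² < ∞`,
let `x_k = a_k (e_0 + e_{k+1})`, and let `L` be the right shift
(`L e_i = e_{i+1}`).  Then the family `{e_i}_i ∪ {2^{-i} L^i x_k}_{i,k}`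
(realized as `z : ℕ ⊕ ℕ × ℕ → ℓ₂`) is a frame for `ℓ₂` which is injective. -/
theorem stmt_17 (a : ℕ → ℝ) (ha : ∀ k, a k ≠ 0)
    (hsum : Summable fun k => a k ^ 2)
    (L : ell2 →L[ℝ] ell2)
    (hL : ∀ i : ℕ, L (lp.single 2 i (1 : ℝ)) = lp.single 2 (i + 1) (1 : ℝ))
    (z : ℕ ⊕ ℕ × ℕ → ell2)
    (hz1 : ∀ i : ℕ, z (Sum.inl i) = lp.single 2 i (1 : ℝ))
    (hz2 : ∀ i k : ℕ, z (Sum.inr (i, k)) =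
      ((2 : ℝ) ^ i)⁻¹ •
        (L ^ i) (a k • (lp.single 2 0 (1 : ℝ) + lp.single 2 (k + 1) (1 : ℝ)))) :
    (∃ A B : ℝ, 0 < A ∧ A ≤ B ∧ ∀ v : ell2,
      A * ‖v‖ ^ 2 ≤ ∑' q, ⟪v, z q⟫_ℝ ^ 2 ∧ ∑' q, ⟪v, z q⟫_ℝ ^ 2 ≤ B * ‖v‖ ^ 2) ∧
    (∀ T : ell2 →L[ℝ] ell2, IsHilbertSchmidt T → IsSelfAdjoint T →
      (∀ q, ⟪T (z q), z q⟫_ℝ = 0) → T = 0) := by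
  have hin : ∀ (v : ell2) (i : ℕ), ⟪v, (lp.single 2 i (1 : ℝ) : ell2)⟫_ℝ = v i := by
    intro v i
    rw [lp.inner_single_right]
    simp
  have hpow : ∀ i j : ℕ, (L ^ i) (lp.single 2 j (1 : ℝ)) = lp.single 2 (j + i) (1 : ℝ) := by
    intro i
    induction i with
    | zero => intro j; simp
    | succ n ih =>
      intro j
      rw [pow_succ, ContinuousLinearMap.mul_apply, hL, ih]
      congr 1
      omega
  have hz3 : ∀ i k : ℕ, z (Sum.inr (i, k)) = (((2 : ℝ) ^ i)⁻¹ * a k) •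
      ((lp.single 2 i (1 : ℝ) : ell2) + lp.single 2 (k + 1 + i) (1 : ℝ)) := by
    intro i k
    rw [hz2, map_smul, map_add, hpow, hpow, smul_smul, Nat.zero_add]
  constructor
  · have hnorm : ∀ v : ell2, HasSum (fun i => (v i) ^ 2) (‖v‖ ^ 2) := by
      intro v
      have h := lp.hasSum_inner (𝕜 := ℝ) v v
      rw [real_inner_self_eq_norm_sq] at h
      simpa [pow_two] using h
    have hcoord : ∀ (v : ell2) (i : ℕ), (v i) ^ 2 ≤ ‖v‖ ^ 2 := by
      intro v i
      exact le_hasSum (hnorm v) i (fun j _ => sq_nonneg _)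
    have hS : Summable fun p : ℕ × ℕ => ((1 / 4 : ℝ) ^ p.1) * a p.2 ^ 2 :=
      (summable_geometric_of_lt_one (r := (1 / 4 : ℝ)) (by norm_num) (by norm_num)).mul_of_nonneg
        hsum (fun i => by positivity) (fun k => by positivity)
    set S := ∑' p : ℕ × ℕ, ((1 / 4 : ℝ) ^ p.1) * a p.2 ^ 2 with hSdef
    have hS0 : 0 ≤ S := tsum_nonneg (fun p => by positivity)
    refine ⟨1, 1 + 4 * S, one_pos, by linarith, fun v => ?_⟩
    have hb : ∀ p : ℕ × ℕ, ⟪v, z (Sum.inr p)⟫_ℝ ^ 2 ≤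
        (((1 / 4 : ℝ) ^ p.1) * a p.2 ^ 2) * (4 * ‖v‖ ^ 2) := by
      rintro ⟨i, k⟩
      rw [hz3, inner_smul_right, inner_add_right, hin, hin, mul_pow, mul_pow]
      have e : ((2 : ℝ) ^ i)⁻¹ ^ 2 = (1 / 4 : ℝ) ^ i := by
        rw [← inv_pow, ← pow_mul, mul_comm, pow_mul]; norm_num
      rw [e]
      apply mul_le_mul_of_nonneg_left _ (by positivity)
      have h1 := hcoord v i
      have h2 := hcoord v (k + 1 + i)
      nlinarith [sq_nonneg (v i - v (k + 1 + i))]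
    have hsr : Summable fun p : ℕ × ℕ => ⟪v, z (Sum.inr p)⟫_ℝ ^ 2 :=
      Summable.of_nonneg_of_le (fun p => sq_nonneg _) hb (hS.mul_right _)
    have hl : HasSum (fun i : ℕ => ⟪v, z (Sum.inl i)⟫_ℝ ^ 2) (‖v‖ ^ 2) := by
      simpa only [hz1, hin] using hnorm v
    have htot : HasSum (fun q => ⟪v, z q⟫_ℝ ^ 2)
        (‖v‖ ^ 2 + ∑' p : ℕ × ℕ, ⟪v, z (Sum.inr p)⟫_ℝ ^ 2) :=
      HasSum.sum hl hsr.hasSum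
    have h0 : 0 ≤ ∑' p : ℕ × ℕ, ⟪v, z (Sum.inr p)⟫_ℝ ^ 2 := tsum_nonneg (fun p => sq_nonneg _)
    have h1 : ∑' p : ℕ × ℕ, ⟪v, z (Sum.inr p)⟫_ℝ ^ 2 ≤ S * (4 * ‖v‖ ^ 2) := by
      rw [hSdef, ← tsum_mul_right]
      exact hsr.tsum_le_tsum hb (hS.mul_right _)
    rw [htot.tsum_eq]
    constructor <;> nlinarith
  · intro T _ hT hq
    have hsym : ∀ x y : ell2, ⟪T x, y⟫_ℝ = ⟪x, T y⟫_ℝ := fun x y => hT.isSymmetric x y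
    have hd : ∀ i : ℕ, ⟪T (lp.single 2 i (1 : ℝ)), (lp.single 2 i (1 : ℝ) : ell2)⟫_ℝ = 0 := by
      intro i
      have := hq (Sum.inl i)
      rwa [hz1] at this
    have hlt : ∀ i k : ℕ,
        ⟪T (lp.single 2 i (1 : ℝ)), (lp.single 2 (k + 1 + i) (1 : ℝ) : ell2)⟫_ℝ = 0 := by
      intro i k
      have h := hq (Sum.inr (i, k))
      have hc : ((2 : ℝ) ^ i)⁻¹ * a k ≠ 0 := mul_ne_zero (by positivity) (ha k)
      rw [hz3, map_smul, inner_smul_left, inner_smul_right, map_add, inner_add_left,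
        inner_add_right, inner_add_right, hd, hd,
        hsym (lp.single 2 (k + 1 + i) (1 : ℝ)) (lp.single 2 i (1 : ℝ)),
        real_inner_comm (T (lp.single 2 i (1 : ℝ)))] at h
      simp only [conj_trivial, mul_eq_zero, hc, false_or] at h
      linarith
    have hall : ∀ i j : ℕ,
        ⟪T (lp.single 2 i (1 : ℝ)), (lp.single 2 j (1 : ℝ) : ell2)⟫_ℝ = 0 := by
      intro i j
      rcases lt_trichotomy i j with h | h | h
      · obtain ⟨k, rfl⟩ : ∃ k, j = k + 1 + i := ⟨j - i - 1, by omega⟩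
        exact hlt i k
      · subst h; exact hd i
      · obtain ⟨k, rfl⟩ : ∃ k, i = k + 1 + j := ⟨i - j - 1, by omega⟩
        rw [hsym, real_inner_comm]
        exact hlt j k
    have hTe : ∀ i : ℕ, T (lp.single 2 i (1 : ℝ)) = 0 := by
      intro i
      ext j
      rw [← hin, hall]
      rfl
    ext v j
    rw [← hin, hsym, hTe, inner_zero_right]
    rfl
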